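/- Fix p ∈ (0,1]. For each n ≥ 3 let s, a, b be three fixed distinct vertices of the random directed graph ⃗G(n,p). Then the relative covariance satisfies lim_{n→∞} (P(a↛s, s↛b) − P(a↛s)·P(s↛b)) / P(a↛s, s↛b) = (2p−1)/3. -/

import Mathlib

open Filter Real

/-- Edges of the complete graph on `Fin n`: ordered pairs `(u,v)` with `u < v`. -/
abbrev Edge (n : ℕ) : Type := {e : Fin n × Fin n // e.1 < e.2}

/-- A configuration of the random edge-orientation model: for each pair `u < v`,
`none` means no edge, `some true` means the directed edge `u → v`, and
`some false` means the directed edge `v → u`. -/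
abbrev Config (n : ℕ) : Type := Edge n → Option Bool

/-- The directed edge relation determined by a configuration. -/
def DirEdge {n : ℕ} (f : Config n) (u v : Fin n) : Prop :=
  (∃ h : u < v, f ⟨(u, v), h⟩ = some true) ∨ (∃ h : v < u, f ⟨(v, u), h⟩ = some false)

/-- `Reaches f u v`: the configuration `f` contains a directed path from `u` to `v`
(paths of length `0` are allowed, so `Reaches f u u` always holds). -/
def Reaches {n : ℕ} (f : Config n) (u v : Fin n) : Prop :=
  Relation.ReflTransGen (DirEdge f) u v

/-- The probability of an event under a weight function on a finite sample space. -/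
noncomputable def prWeight {α : Type*} [Fintype α] (w : α → ℝ) (E : Set α) : ℝ :=
  ∑ x, E.indicator w x

/-- The weight of one edge state in `⃗G(n,p)`: no edge has probability `1 - p`
and each of the two orientations has probability `p/2`. -/
noncomputable def edgeWeight (p : ℝ) : Option Bool → ℝ
  | none => 1 - p
  | some _ => p / 2

/-- The probability of an event in the random directed graph `⃗G(n,p)`. -/
noncomputable def PrGnp (n : ℕ) (p : ℝ) (E : Set (Config n)) : ℝ :=
  prWeight (fun f => ∏ e : Edge n, edgeWeight p (f e)) E

/-- The number of present edges of a configuration. -/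
def edgeCount {n : ℕ} (f : Config n) : ℕ :=
  (Finset.univ.filter fun e : Edge n => (f e).isSome).card

/-- The probability of an event in the random directed graph `⃗G(n,m)`:
the underlying graph is uniform among the graphs with exactly `m` edges, and each
present edge is oriented in one of its two directions with probability `1/2`,
independently over edges. -/
noncomputable def PrGnm (n m : ℕ) (E : Set (Config n)) : ℝ :=
  prWeight (fun f => if edgeCount f = m
      then ((Nat.choose (Nat.choose n 2) m : ℝ) * 2 ^ m)⁻¹ else 0) E


section FiniteWeights

variable {α : Type*} [Fintype α] {w : α → ℝ}

theorem prWeight_mono (hw : ∀ x, 0 ≤ w x) {E F : Set α} (h : E ⊆ F) :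
    prWeight w E ≤ prWeight w F :=
  Finset.sum_le_sum fun x _ => Set.indicator_le_indicator_of_subset h hw x

theorem prWeight_union_add_inter (E F : Set α) :
    prWeight w (E ∪ F) + prWeight w (E ∩ F) = prWeight w E + prWeight w F := by
  unfold prWeight
  rw [← Finset.sum_add_distrib, ← Finset.sum_add_distrib]
  exact Finset.sum_congr rfl fun x _ => Set.indicator_union_add_inter_apply w E F x

theorem prWeight_nonneg (hw : ∀ x, 0 ≤ w x) (E : Set α) : 0 ≤ prWeight w E :=
  Finset.sum_nonneg fun x _ => Set.indicator_nonneg (fun y _ => hw y) x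

theorem prWeight_union_le (hw : ∀ x, 0 ≤ w x) (E F : Set α) :
    prWeight w (E ∪ F) ≤ prWeight w E + prWeight w F := by
  have h₁ := prWeight_union_add_inter (w := w) E F
  have h₂ := prWeight_nonneg hw (E ∩ F)
  linarith

theorem prWeight_le_sum (hw : ∀ x, 0 ≤ w x) {ι : Type*} (S : Finset ι) (G : ι → Set α)
    {E : Set α} (h : ∀ x ∈ E, ∃ i ∈ S, x ∈ G i) :
    prWeight w E ≤ ∑ i ∈ S, prWeight w (G i) := by
  unfold prWeight
  rw [Finset.sum_comm]
  refine Finset.sum_le_sum fun x _ => ?_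
  by_cases hx : x ∈ E
  · obtain ⟨i, hi, hxi⟩ := h x hx
    rw [Set.indicator_of_mem hx]
    refine le_trans (Set.indicator_of_mem hxi w).ge ?_
    exact Finset.single_le_sum (f := fun i => (G i).indicator w x)
      (fun j _ => Set.indicator_nonneg (fun y _ => hw y) x) hi
  · rw [Set.indicator_of_notMem hx]
    exact Finset.sum_nonneg fun j _ => Set.indicator_nonneg (fun y _ => hw y) x

end FiniteWeights

section MonotoneLabellings

variable {N : ℕ} {p : ℝ}

theorem edgeWeight_nonneg (h0 : 0 ≤ p) (h1 : p ≤ 1) (o : Option Bool) : 0 ≤ edgeWeight p o := by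
  cases o <;> simp only [edgeWeight] <;> linarith

theorem configWeight_nonneg (h0 : 0 ≤ p) (h1 : p ≤ 1) (f : Config N) :
    0 ≤ ∏ e : Edge N, edgeWeight p (f e) :=
  Finset.prod_nonneg fun _ _ => edgeWeight_nonneg h0 h1 _

/-- The configurations all of whose directed edges are increasing for the labelling `c`. -/
def monotoneConfigs {L : Type*} [LE L] (c : Fin N → L) : Set (Config N) :=
  {f | ∀ u v, DirEdge f u v → c u ≤ c v}

/-- The probability that a pair labelled `x`, `y` carries no decreasing edge. -/
noncomputable def pairWeight {L : Type*} [LE L] [DecidableLE L] (p : ℝ) (x y : L) : ℝ :=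
  (1 - p) + ((if x ≤ y then p / 2 else 0) + (if y ≤ x then p / 2 else 0))

theorem PrGnp_monotoneConfigs {L : Type*} [LE L] [DecidableLE L] (c : Fin N → L) :
    PrGnp N p (monotoneConfigs c) = ∏ e : Edge N, pairWeight p (c e.1.1) (c e.1.2) := by
  classical
  let φ : Edge N → Option Bool → ℝ := fun e o =>
    match o with
    | none => 1 - p
    | some true => if c e.1.1 ≤ c e.1.2 then p / 2 else 0
    | some false => if c e.1.2 ≤ c e.1.1 then p / 2 else 0
  have h1 : ∀ e : Edge N, pairWeight p (c e.1.1) (c e.1.2) = ∑ o, φ e o := by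
    intro e
    simp [Fintype.sum_option, φ, pairWeight]
  simp_rw [h1]
  rw [Finset.prod_univ_sum, Fintype.piFinset_univ]
  unfold PrGnp prWeight
  refine Finset.sum_congr rfl fun f _ => ?_
  by_cases hf : f ∈ monotoneConfigs c
  · rw [Set.indicator_of_mem hf]
    refine Finset.prod_congr rfl fun e _ => ?_
    rcases ho : f e with _ | _ | _
    · rfl
    · have : c e.1.2 ≤ c e.1.1 := hf _ _ (Or.inr ⟨e.2, ho⟩)
      simp [φ, this, edgeWeight]
    · have : c e.1.1 ≤ c e.1.2 := hf _ _ (Or.inl ⟨e.2, ho⟩)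
      simp [φ, this, edgeWeight]
  · rw [Set.indicator_of_notMem hf]
    simp only [monotoneConfigs, Set.mem_ofPred_eq, not_forall] at hf
    obtain ⟨u, v, hd, hc⟩ := hf
    symm
    rcases hd with ⟨h, ho⟩ | ⟨h, ho⟩
    · exact Finset.prod_eq_zero (Finset.mem_univ ⟨(u, v), h⟩) (by simp [ho, φ, hc])
    · exact Finset.prod_eq_zero (Finset.mem_univ ⟨(v, u), h⟩) (by simp [ho, φ, hc])

theorem prod_edge_sq (F : Fin N → Fin N → ℝ) (hs : ∀ u v, F u v = F v u) (hd : ∀ u, F u u = 1) :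
    (∏ e : Edge N, F e.1.1 e.1.2) ^ 2 = ∏ u, ∏ v, F u v := by
  have h1 : ∏ e : Edge N, F e.1.1 e.1.2 =
      ∏ x : Fin N × Fin N, if x.1 < x.2 then F x.1 x.2 else 1 := by
    rw [← Finset.prod_filter]
    exact (Finset.prod_subtype (p := fun x : Fin N × Fin N => x.1 < x.2) _ (by simp)
      (fun x : Fin N × Fin N => F x.1 x.2)).symm
  have h2 : ∏ e : Edge N, F e.1.1 e.1.2 =
      ∏ x : Fin N × Fin N, if x.2 < x.1 then F x.1 x.2 else 1 := by
    rw [h1, ← Equiv.prod_comp (Equiv.prodComm _ _)]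
    refine Finset.prod_congr rfl fun x _ => ?_
    simp only [Equiv.prodComm_apply, Prod.fst_swap, Prod.snd_swap, hs x.2 x.1]
  rw [sq]
  nth_rewrite 1 [h1]
  rw [h2, ← Finset.prod_mul_distrib, ← Fintype.prod_prod_type']
  refine Finset.prod_congr rfl fun x _ => ?_
  rcases lt_trichotomy x.1 x.2 with h | h | h
  · simp [h, h.not_gt]
  · simp [h, hd]
  · simp [h, h.not_gt]

/-- The number of vertices with label `x`. -/
def labelCount {L : Type*} [DecidableEq L] (c : Fin N → L) (x : L) : ℕ :=
  (Finset.univ.filter fun v => c v = x).card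

theorem prod_comp_label {L : Type*} [Fintype L] [DecidableEq L] (c : Fin N → L) (g : L → ℝ) :
    ∏ v, g (c v) = ∏ x, g x ^ labelCount c x := by
  rw [← Finset.prod_fiberwise Finset.univ c]
  refine Finset.prod_congr rfl fun x _ => ?_
  rw [labelCount, ← Finset.prod_const]
  exact Finset.prod_congr rfl fun v hv => by rw [(Finset.mem_filter.mp hv).2]

theorem PrGnp_monotoneConfigs_sq {L : Type*} [PartialOrder L] [DecidableLE L] [Fintype L]
    [DecidableEq L] (c : Fin N → L) :
    PrGnp N p (monotoneConfigs c) ^ 2 =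
      ∏ x, (∏ y, pairWeight p x y ^ labelCount c y) ^ labelCount c x := by
  rw [PrGnp_monotoneConfigs, prod_edge_sq (fun u v => pairWeight p (c u) (c v))]
  · rw [← prod_comp_label c fun x => ∏ y, pairWeight p x y ^ labelCount c y]
    exact Finset.prod_congr rfl fun u _ => prod_comp_label c _
  · intro u v
    simp only [pairWeight]
    ring
  · intro u
    simp [pairWeight]

theorem PrGnp_monotoneConfigs_bool (h0 : 0 ≤ p) (h1 : p ≤ 1) (c : Fin N → Bool × Bool)
    {α β γ δ : ℕ} (hα : labelCount c (true, true) = α) (hβ : labelCount c (true, false) = β)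
    (hγ : labelCount c (false, true) = γ) (hδ : labelCount c (false, false) = δ) :
    PrGnp N p (monotoneConfigs c) =
      (1 - p / 2) ^ (α * (β + γ + δ) + (β + γ) * δ) * (1 - p) ^ (β * γ) := by
  have hP : 0 ≤ PrGnp N p (monotoneConfigs c) := prWeight_nonneg (configWeight_nonneg h0 h1) _
  have hq : 0 ≤ 1 - p / 2 := by linarith
  have hr : 0 ≤ 1 - p := by linarith
  refine (pow_left_inj₀ hP (by positivity) two_ne_zero).mp ?_
  rw [PrGnp_monotoneConfigs_sq]
  simp only [Fintype.prod_prod_type, Fintype.prod_bool, pairWeight, Prod.mk_le_mk, le_refl,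
    Bool.false_le, hα, hβ, hγ, hδ]
  have e2 : 1 - p + p / 2 = 1 - p / 2 := by ring
  simp [e2, show ¬ (true ≤ false) by decide]
  ring

end MonotoneLabellings

section LabelCost

variable {N : ℕ} {p : ℝ}

/-- The exponent of `1 - p / 2` in the bound for the probability of `monotoneConfigs c`. -/
def labelCost (c : Fin N → Bool × Bool) : ℕ :=
  labelCount c (true, true) *
      (labelCount c (true, false) + labelCount c (false, true) + labelCount c (false, false)) +
    (labelCount c (true, false) + labelCount c (false, true)) * labelCount c (false, false) +
    2 * (labelCount c (true, false) * labelCount c (false, true))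

theorem PrGnp_monotoneConfigs_le (h0 : 0 ≤ p) (h1 : p ≤ 1) (c : Fin N → Bool × Bool) :
    PrGnp N p (monotoneConfigs c) ≤ (1 - p / 2) ^ labelCost c := by
  rw [PrGnp_monotoneConfigs_bool h0 h1 c rfl rfl rfl rfl, labelCost, pow_add _ (_ + _),
    pow_mul _ 2]
  have hq : 0 ≤ 1 - p / 2 := by linarith
  have hr : 0 ≤ 1 - p := by linarith
  have : 1 - p ≤ (1 - p / 2) ^ 2 := by nlinarith [sq_nonneg p]
  gcongr

theorem sum_labelCount {L : Type*} [Fintype L] [DecidableEq L] (c : Fin N → L) :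
    ∑ x, labelCount c x = N := by
  simpa [labelCount] using (Finset.card_eq_sum_card_fiberwise (s := Finset.univ) (t := Finset.univ)
    (f := c) (by simp)).symm

theorem labelCount_bool_sum (c : Fin N → Bool × Bool) :
    labelCount c (true, true) + labelCount c (true, false) + labelCount c (false, true) +
      labelCount c (false, false) = N := by
  have := sum_labelCount c
  simp only [Fintype.sum_prod_type, Fintype.sum_bool] at this
  omega

theorem labelCount_mul_le_labelCost (c : Fin N → Bool × Bool) (j : Bool × Bool) :
    labelCount c j * (N - labelCount c j) ≤ labelCost c := by
  have key : ∀ α β γ δ : ℕ, α + β + γ + δ = N →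
      let D := α * (β + γ + δ) + (β + γ) * δ + 2 * (β * γ)
      α * (N - α) ≤ D ∧ β * (N - β) ≤ D ∧ γ * (N - γ) ≤ D ∧ δ * (N - δ) ≤ D := by
    rintro α β γ δ rfl
    have h₁ := Nat.zero_le (α * β)
    have h₂ := Nat.zero_le (α * γ)
    have h₃ := Nat.zero_le (α * δ)
    have h₄ := Nat.zero_le (β * γ)
    have h₅ := Nat.zero_le (β * δ)
    have h₆ := Nat.zero_le (γ * δ)
    refine ⟨?_, ?_, ?_, ?_⟩
    · rw [show α + β + γ + δ - α = β + γ + δ by omega]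
      linarith
    · rw [show α + β + γ + δ - β = α + γ + δ by omega]
      linarith
    · rw [show α + β + γ + δ - γ = α + β + δ by omega]
      linarith
    · rw [show α + β + γ + δ - δ = α + β + γ by omega]
      linarith
  obtain ⟨h₁, h₂, h₃, h₄⟩ := key _ _ _ _ (labelCount_bool_sum c)
  rcases j with ⟨_ | _, _ | _⟩ <;> assumption

theorem pair_count_lower_bound {N m k : ℕ} (hk : k ≤ 3) (hN : 24 ≤ N) (hm : N ≤ 4 * m)
    (hmk : m + k ≤ N) : k * (N - k - N / 8) + (N - m) * (N / 8) ≤ m * (N - m) := by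
  obtain ⟨l, rfl⟩ : ∃ l, N = m + k + l := ⟨N - (m + k), by omega⟩
  generalize hM : (m + k + l) / 8 = M
  obtain ⟨r, rfl⟩ : ∃ r, m = k + M + r := ⟨m - (k + M), by omega⟩
  have e1 : k + M + r + k + l - k - M = r + k + l := by omega
  have e2 : k + M + r + k + l - (k + M + r) = k + l := by omega
  rw [e1, e2]
  nlinarith [Nat.zero_le (r * l)]

/-- The bound for the total probability of the labellings of large cost. -/
noncomputable def tailBound (N : ℕ) (p : ℝ) (k : ℕ) : ℝ :=
  (1 - p / 2) ^ (k * (N - k - N / 8)) * (4 * (1 + 3 * (1 - p / 2) ^ (N / 8)) ^ N)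

theorem sum_pow_compl_labelCount {L : Type*} [Fintype L] [DecidableEq L] (j : L) (t : ℝ) :
    ∑ c : Fin N → L, t ^ (N - labelCount c j) = (1 + (Fintype.card L - 1 : ℕ) * t) ^ N := by
  have h : ∀ c : Fin N → L, t ^ (N - labelCount c j) = ∏ v, if c v = j then 1 else t := by
    intro c
    rw [Finset.prod_ite, Finset.prod_const_one, one_mul, Finset.prod_const]
    congr 1
    have := Finset.card_filter_add_card_filter_not (s := Finset.univ) (fun v => c v = j)
    simp only [labelCount, Finset.card_univ, Fintype.card_fin] at *
    omega
  simp_rw [h]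
  rw [← Fintype.piFinset_univ, ← Finset.prod_univ_sum (fun _ => Finset.univ)
    fun _ x => if x = j then 1 else t]
  simp [Finset.sum_ite, Finset.filter_eq', Finset.filter_ne', Finset.card_erase_of_mem]

theorem PrGnp_le_tailBound (h0 : 0 ≤ p) (h1 : p ≤ 1) (k : ℕ) {E : Set (Config N)}
    (hE : ∀ f ∈ E, ∃ c, f ∈ monotoneConfigs c ∧ ∃ j : Bool × Bool,
      k * (N - k - N / 8) + (N - labelCount c j) * (N / 8) ≤ labelCost c) :
    PrGnp N p E ≤ tailBound N p k := by
  classical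
  have hq : 0 ≤ 1 - p / 2 := by linarith
  have hq1 : 1 - p / 2 ≤ 1 := by linarith
  let S : Finset ((Bool × Bool) × (Fin N → Bool × Bool)) := Finset.univ.filter fun x =>
    k * (N - k - N / 8) + (N - labelCount x.2 x.1) * (N / 8) ≤ labelCost x.2
  calc PrGnp N p E ≤ ∑ x ∈ S, PrGnp N p (monotoneConfigs x.2) := by
        refine prWeight_le_sum (configWeight_nonneg h0 h1) S _ fun f hf => ?_
        obtain ⟨c, hfc, j, hj⟩ := hE f hf
        exact ⟨(j, c), by simpa [S] using hj, hfc⟩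
    _ ≤ ∑ x ∈ S, (1 - p / 2) ^ (k * (N - k - N / 8)) *
          ((1 - p / 2) ^ (N / 8)) ^ (N - labelCount x.2 x.1) := by
        refine Finset.sum_le_sum fun x hx => (PrGnp_monotoneConfigs_le h0 h1 _).trans ?_
        rw [← pow_mul, ← pow_add, mul_comm (N / 8)]
        exact pow_le_pow_of_le_one hq hq1 (Finset.mem_filter.mp hx).2
    _ ≤ ∑ x : (Bool × Bool) × (Fin N → Bool × Bool), (1 - p / 2) ^ (k * (N - k - N / 8)) *
          ((1 - p / 2) ^ (N / 8)) ^ (N - labelCount x.2 x.1) :=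
        Finset.sum_le_sum_of_subset_of_nonneg (Finset.subset_univ _) fun _ _ _ => by positivity
    _ = tailBound N p k := by
        rw [← Finset.mul_sum, Fintype.sum_prod_type]
        simp_rw [sum_pow_compl_labelCount]
        simp [tailBound]

theorem exists_large_label (c : Fin N → Bool × Bool) {k : ℕ} (hk : k ≤ 3) (hN : 24 ≤ N) :
    (∃ j, k * (N - k - N / 8) + (N - labelCount c j) * (N / 8) ≤ labelCost c) ∨
      ∃ j, N < labelCount c j + k := by
  obtain ⟨j, hj⟩ : ∃ j, N ≤ 4 * labelCount c j := by
    by_contra! h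
    have h₁ := labelCount_bool_sum c
    have h₂ := h (true, true)
    have h₃ := h (true, false)
    have h₄ := h (false, true)
    have h₅ := h (false, false)
    omega
  by_cases h : labelCount c j + k ≤ N
  · exact Or.inl ⟨j, (pair_count_lower_bound hk hN hj h).trans (labelCount_mul_le_labelCost c j)⟩
  · exact Or.inr ⟨j, by omega⟩

end LabelCost

section ClosedSets

variable {N : ℕ} {p : ℝ}

/-- The configurations for which no directed edge leaves `X` and none leaves `Y`. -/
def closedConfigs (X Y : Finset (Fin N)) : Set (Config N) :=
  {f | ∀ u v, DirEdge f u v → (u ∈ X → v ∈ X) ∧ (u ∈ Y → v ∈ Y)}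

/-- The labelling of the vertices by membership in `X` and in `Y`. -/
def memLabel (X Y : Finset (Fin N)) (v : Fin N) : Bool × Bool :=
  (decide (v ∈ X), decide (v ∈ Y))

theorem closedConfigs_eq (X Y : Finset (Fin N)) :
    closedConfigs X Y = monotoneConfigs (memLabel X Y) := by
  ext f
  simp [closedConfigs, monotoneConfigs, memLabel, Prod.mk_le_mk, Bool.le_iff_imp]

theorem PrGnp_closedConfigs (h0 : 0 ≤ p) (h1 : p ≤ 1) {X Y : Finset (Fin N)} (h : X ⊆ Y) :
    PrGnp N p (closedConfigs X Y) = (1 - p / 2) ^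
      (X.card * (Y.card - X.card + (N - Y.card)) + (Y.card - X.card) * (N - Y.card)) := by
  rw [closedConfigs_eq, PrGnp_monotoneConfigs_bool h0 h1 (memLabel X Y) (α := X.card) (β := 0)
    (γ := Y.card - X.card) (δ := N - Y.card)]
  · simp
  · unfold labelCount memLabel
    congr 1
    ext v
    simpa using fun hv => h hv
  · simpa [labelCount, memLabel] using fun v hv => h hv
  · rw [← Finset.card_sdiff_of_subset h]
    unfold labelCount memLabel
    congr 1
    ext v
    simp [and_comm]
  · have := Finset.card_compl Y
    rw [Fintype.card_fin] at this
    rw [← this]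
    unfold labelCount memLabel
    congr 1
    ext v
    simpa using fun hv hx => hv (h hx)

theorem PrGnp_isolated (h0 : 0 ≤ p) (h1 : p ≤ 1) (s : Fin N) :
    PrGnp N p (closedConfigs {s}ᶜ {s}) = (1 - p) ^ (N - 1) := by
  rw [closedConfigs_eq, PrGnp_monotoneConfigs_bool h0 h1 _ (α := 0) (β := N - 1)
    (γ := 1) (δ := 0)]
  · simp
  · simp [labelCount, memLabel]
  · have := Finset.card_compl ({s} : Finset (Fin N))
    rw [Finset.card_singleton, Fintype.card_fin] at this
    rw [← this]
    unfold labelCount memLabel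
    congr 1
    ext v
    simp
  · simp [labelCount, memLabel, Finset.filter_eq']
  · simp [labelCount, memLabel]

theorem not_reaches_of_closed {f : Config N} {X : Finset (Fin N)} {u v : Fin N}
    (hX : ∀ x y, DirEdge f x y → x ∈ X → y ∈ X) (hu : u ∈ X) (hv : v ∉ X) : ¬ Reaches f u v := by
  intro h
  apply hv
  clear hv
  induction h with
  | refl => exact hu
  | tail _ hxy ih => exact hX _ _ hxy ih

open Classical in
/-- The vertices that can be reached from `u`. -/
noncomputable def reachSet (f : Config N) (u : Fin N) : Finset (Fin N) :=
  Finset.univ.filter fun v => Reaches f u v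

theorem mem_reachSet {f : Config N} {u v : Fin N} : v ∈ reachSet f u ↔ Reaches f u v := by
  simp [reachSet]

theorem self_mem_reachSet (f : Config N) (u : Fin N) : u ∈ reachSet f u :=
  mem_reachSet.mpr Relation.ReflTransGen.refl

theorem reachSet_closed (f : Config N) (u : Fin N) {x y : Fin N} (h : DirEdge f x y)
    (hx : x ∈ reachSet f u) : y ∈ reachSet f u :=
  mem_reachSet.mpr (Relation.ReflTransGen.tail (mem_reachSet.mp hx) h)

theorem mem_closedConfigs_reachSet (f : Config N) (u v : Fin N) :
    f ∈ closedConfigs (reachSet f u) (reachSet f v) :=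
  fun _ _ h => ⟨reachSet_closed f u h, reachSet_closed f v h⟩

theorem label_eq_of_lt {L : Type*} [DecidableEq L] {c : Fin N → L} {j : L} {k : ℕ}
    (h : N < labelCount c j + k) (S : Finset (Fin N)) (hS : ∀ v ∈ S, c v ≠ j)
    (hk : k ≤ S.card + 1) {v : Fin N} (hv : v ∉ S) : c v = j := by
  by_contra hc
  have h₁ : (insert v S).card ≤ (Finset.univ.filter fun v => ¬ c v = j).card := by
    refine Finset.card_le_card fun x hx => ?_
    rcases Finset.mem_insert.mp hx with rfl | hx
    · simpa using hc
    · simpa using hS x hx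
  rw [Finset.card_insert_of_notMem hv] at h₁
  have h₂ := Finset.card_filter_add_card_filter_not (s := Finset.univ) (fun v => c v = j)
  simp only [labelCount, Finset.card_univ, Fintype.card_fin] at *
  omega

theorem labelCount_pos {L : Type*} [DecidableEq L] {c : Fin N → L} {v : Fin N} {j : L}
    (h : c v = j) : 0 < labelCount c j :=
  Finset.card_pos.mpr ⟨v, by simpa using h⟩

theorem card_le_labelCount {L : Type*} [DecidableEq L] {c : Fin N → L} {j : L}
    (S : Finset (Fin N)) (h : ∀ v ∈ S, c v = j) : S.card ≤ labelCount c j :=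
  Finset.card_le_card fun v hv => by simpa using h v hv

theorem pow_le_tailBound (h0 : 0 ≤ p) (h1 : p ≤ 1) {k e : ℕ} (h : k * (N - k - N / 8) ≤ e) :
    (1 - p / 2) ^ e ≤ tailBound N p k := by
  have hq : 0 ≤ 1 - p / 2 := by linarith
  have hq1 : 1 - p / 2 ≤ 1 := by linarith
  refine (pow_le_pow_of_le_one hq hq1 h).trans (le_mul_of_one_le_right (by positivity) ?_)
  have : (1 : ℝ) ≤ (1 + 3 * (1 - p / 2) ^ (N / 8)) ^ N := by
    apply one_le_pow₀
    have : 0 ≤ (1 - p / 2) ^ (N / 8) := by positivity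
    linarith
  linarith

/-- The configurations lying in `monotoneConfigs c` for a labelling `c` of large cost. -/
def highCostConfigs (N k : ℕ) : Set (Config N) :=
  {f | ∃ c, f ∈ monotoneConfigs c ∧ ∃ j : Bool × Bool,
      k * (N - k - N / 8) + (N - labelCount c j) * (N / 8) ≤ labelCost c}

theorem PrGnp_highCostConfigs_le (h0 : 0 ≤ p) (h1 : p ≤ 1) (k : ℕ) :
    PrGnp N p (highCostConfigs N k) ≤ tailBound N p k :=
  PrGnp_le_tailBound h0 h1 k fun _ hf => hf

theorem not_reaches_subset {a s : Fin N} (has : a ≠ s) (hN : 24 ≤ N) :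
    {f | ¬ Reaches f a s} ⊆
      closedConfigs {a} {a} ∪ closedConfigs {s}ᶜ {s}ᶜ ∪ highCostConfigs N 2 := by
  intro f hf
  have hs : s ∉ reachSet f a := fun h => hf (mem_reachSet.mp h)
  have ha := self_mem_reachSet f a
  have hcl := fun {x y} => reachSet_closed f a (x := x) (y := y)
  have hmem := mem_closedConfigs_reachSet f a a
  rw [closedConfigs_eq] at hmem
  rcases exists_large_label (memLabel (reachSet f a) (reachSet f a)) (k := 2) (by norm_num) hN
    with h | ⟨j, hj⟩
  · exact Or.inr ⟨_, hmem, h⟩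
  left
  generalize reachSet f a = X at *
  have hone := fun (u : Fin N) (hu : memLabel X X u ≠ j) (v : Fin N) (hv : v ≠ u) =>
    label_eq_of_lt hj {u} (by simpa using hu) (by simp) (v := v) (by simpa using hv)
  rcases j with ⟨_ | _, _ | _⟩ <;> simp only [memLabel, ne_eq, Prod.mk.injEq, decide_eq_true_eq,
    decide_eq_false_iff_not] at hone
  · left
    intro u v huv
    simp only [Finset.mem_singleton]
    grind
  · grind
  · grind
  · right
    intro u v huv
    simp only [Finset.mem_compl, Finset.mem_singleton]
    grind

theorem abs_PrGnp_not_reaches_sub_le (h0 : 0 ≤ p) (h1 : p ≤ 1) {a s : Fin N} (has : a ≠ s)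
    (hN : 24 ≤ N) :
    |PrGnp N p {f | ¬ Reaches f a s} - 2 * (1 - p / 2) ^ (N - 1)| ≤ tailBound N p 2 := by
  have hw := configWeight_nonneg (N := N) h0 h1
  have hO : PrGnp N p (closedConfigs {a} {a}) = (1 - p / 2) ^ (N - 1) := by
    rw [PrGnp_closedConfigs h0 h1 subset_rfl]
    simp
  have hI : PrGnp N p (closedConfigs {s}ᶜ {s}ᶜ) = (1 - p / 2) ^ (N - 1) := by
    rw [PrGnp_closedConfigs h0 h1 subset_rfl, Finset.card_compl, Finset.card_singleton,
      Fintype.card_fin, show N - (N - 1) = 1 by omega]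
    simp
  have hOI : PrGnp N p (closedConfigs {a} {a} ∩ closedConfigs {s}ᶜ {s}ᶜ) ≤ tailBound N p 2 := by
    refine (prWeight_mono hw (F := closedConfigs {a} {s}ᶜ)
      fun f hf u v huv => ⟨(hf.1 u v huv).1, (hf.2 u v huv).1⟩).trans ?_
    refine (PrGnp_closedConfigs h0 h1 (by simpa using has.symm)).trans_le ?_
    rw [Finset.card_compl, Finset.card_singleton, Finset.card_singleton, Fintype.card_fin,
      show N - (N - 1) = 1 by omega]
    exact pow_le_tailBound h0 h1 (by omega)
  have hlow : PrGnp N p (closedConfigs {a} {a} ∪ closedConfigs {s}ᶜ {s}ᶜ) ≤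
      PrGnp N p {f | ¬ Reaches f a s} := by
    refine prWeight_mono hw ?_
    rintro f (hf | hf)
    · exact not_reaches_of_closed (fun x y h => (hf x y h).1) (by simp) (by simpa using has.symm)
    · exact not_reaches_of_closed (fun x y h => (hf x y h).1) (by simpa using has) (by simp)
  have hup := (prWeight_mono hw (not_reaches_subset has hN)).trans (prWeight_union_le hw _ _)
  have hie := prWeight_union_add_inter (w := fun f => ∏ e : Edge N, edgeWeight p (f e))
    (closedConfigs {a} {a}) (closedConfigs {s}ᶜ {s}ᶜ)
  have hT := PrGnp_highCostConfigs_le (N := N) h0 h1 2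
  have hnn := prWeight_nonneg hw (closedConfigs {a} {a} ∩ closedConfigs {s}ᶜ {s}ᶜ)
  unfold PrGnp at *
  rw [abs_le]
  constructor <;> linarith

theorem labelCost_of_two_labels {c : Fin N → Bool × Bool} (hN : 24 ≤ N) {x y : Bool × Bool}
    (hxy : x = (true, false) ∧ y = (false, true) ∨ x = (false, true) ∧ y = (true, false))
    (hx : labelCount c x + 2 = N) (hy : 1 ≤ labelCount c y) :
    3 * (N - 3 - N / 8) + (N - labelCount c x) * (N / 8) ≤ labelCost c := by
  have hs := labelCount_bool_sum c
  have hM : 3 * (N - 3 - N / 8) + (N - labelCount c x) * (N / 8) ≤ 3 * labelCount c x := by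
    rw [show N - labelCount c x = 2 by omega]
    omega
  refine hM.trans ?_
  unfold labelCost
  rcases hxy with ⟨rfl, rfl⟩ | ⟨rfl, rfl⟩
  · generalize labelCount c (true, true) = α at *
    generalize labelCount c (true, false) = β at *
    generalize labelCount c (false, true) = γ at *
    generalize labelCount c (false, false) = δ at *
    obtain ⟨g, rfl⟩ : ∃ g, γ = g + 1 := ⟨γ - 1, by omega⟩
    have e : β * (α + g + δ) = β * 1 := by rw [show α + g + δ = 1 by omega]
    nlinarith [Nat.zero_le (α * (g + 1)), Nat.zero_le (α * δ), Nat.zero_le ((g + 1) * δ),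
      Nat.zero_le (β * g)]
  · generalize labelCount c (true, true) = α at *
    generalize labelCount c (true, false) = γ at *
    generalize labelCount c (false, true) = β at *
    generalize labelCount c (false, false) = δ at *
    obtain ⟨g, rfl⟩ : ∃ g, γ = g + 1 := ⟨γ - 1, by omega⟩
    have e : β * (α + g + δ) = β * 1 := by rw [show α + g + δ = 1 by omega]
    nlinarith [Nat.zero_le (α * (g + 1)), Nat.zero_le (α * δ), Nat.zero_le ((g + 1) * δ),
      Nat.zero_le (β * g)]

theorem not_reaches_inter_subset {a s b : Fin N} (has : a ≠ s) (hsb : s ≠ b) (hab : a ≠ b)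
    (hN : 24 ≤ N) :
    {f | ¬ Reaches f a s ∧ ¬ Reaches f s b} ⊆
      (closedConfigs {a} {a, s} ∪ closedConfigs {a} {b}ᶜ ∪ closedConfigs {s, b}ᶜ {b}ᶜ) ∪
        (closedConfigs {s}ᶜ {s} ∪ highCostConfigs N 3) := by
  rintro f ⟨hf₁, hf₂⟩
  have hs : s ∉ reachSet f a := fun h => hf₁ (mem_reachSet.mp h)
  have hb : b ∉ reachSet f s := fun h => hf₂ (mem_reachSet.mp h)
  have ha := self_mem_reachSet f a
  have hs' := self_mem_reachSet f s
  have hcl₁ := fun x y => reachSet_closed f a (x := x) (y := y)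
  have hcl₂ := fun x y => reachSet_closed f s (x := x) (y := y)
  have hmem := mem_closedConfigs_reachSet f a s
  rw [closedConfigs_eq] at hmem
  clear hf₁ hf₂
  generalize reachSet f a = X at *
  generalize reachSet f s = Y at *
  by_cases hcost : ∃ j : Bool × Bool, 3 * (N - 3 - N / 8) +
      (N - labelCount (memLabel X Y) j) * (N / 8) ≤ labelCost (memLabel X Y)
  · exact Or.inr (Or.inr ⟨_, hmem, hcost⟩)
  obtain ⟨j, hj⟩ := (exists_large_label (memLabel X Y) (k := 3) le_rfl hN).resolve_left hcost
  have htwo := fun (u w : Fin N) (huw : u ≠ w) (hu : memLabel X Y u ≠ j)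
      (hw : memLabel X Y w ≠ j) (v : Fin N) (hv : v ≠ u ∧ v ≠ w) =>
    label_eq_of_lt hj {u, w} (by simpa using ⟨hu, hw⟩) (by simp [Finset.card_pair huw]) (v := v)
      (by simpa using hv)
  have hsum := labelCount_bool_sum (memLabel X Y)
  have hsl : memLabel X Y s = (false, true) := by simp [memLabel, hs, hs']
  have hspos := labelCount_pos hsl
  rcases j with ⟨_ | _, _ | _⟩
  · have h := htwo a s has (by simp [memLabel, ha]) (by simp [hsl])
    simp only [memLabel, Prod.mk.injEq, decide_eq_false_iff_not] at h
    refine Or.inl (Or.inl (Or.inl fun u v huv => ?_))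
    simp only [Finset.mem_insert, Finset.mem_singleton]
    grind
  · have h := htwo a b hab (by simp [memLabel, ha]) (by simp [memLabel, hb])
    simp only [memLabel, Prod.mk.injEq, decide_eq_false_iff_not, decide_eq_true_eq] at h
    by_cases hboth : a ∉ Y ∧ b ∈ X
    · have := card_le_labelCount (c := memLabel X Y) (j := (true, false)) {a, b}
        (by simp [memLabel, ha, hb, hboth])
      rw [Finset.card_pair hab] at this
      exact absurd ⟨_, labelCost_of_two_labels hN (Or.inr ⟨rfl, rfl⟩) (by omega) (by omega)⟩ hcost
    · refine Or.inl (Or.inl (Or.inr fun u v huv => ?_))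
      simp only [Finset.mem_compl, Finset.mem_singleton]
      grind
  · by_cases hone : labelCount (memLabel X Y) (true, false) + 1 = N
    · have h := fun v (hv : v ≠ s) => label_eq_of_lt (c := memLabel X Y) (j := (true, false))
        (k := 2) (by omega) {s} (by simp [hsl]) (by simp) (v := v) (by simpa using hv)
      simp only [memLabel, Prod.mk.injEq, decide_eq_false_iff_not, decide_eq_true_eq] at h
      refine Or.inr (Or.inl fun u v huv => ?_)
      simp only [Finset.mem_compl, Finset.mem_singleton]
      grind
    · exact absurd ⟨_, labelCost_of_two_labels hN (Or.inl ⟨rfl, rfl⟩) (by omega) hspos⟩ hcost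
  · have h := htwo s b hsb (by simp [hsl]) (by simp [memLabel, hb])
    simp only [memLabel, Prod.mk.injEq, decide_eq_true_eq] at h
    refine Or.inl (Or.inr fun u v huv => ?_)
    simp only [Finset.mem_compl, Finset.mem_insert, Finset.mem_singleton]
    grind

theorem subset_not_reaches_inter {a s b : Fin N} (has : a ≠ s) (hsb : s ≠ b) (hab : a ≠ b) :
    closedConfigs {a} {a, s} ∪ closedConfigs {a} {b}ᶜ ∪ closedConfigs {s, b}ᶜ {b}ᶜ ⊆
      {f | ¬ Reaches f a s ∧ ¬ Reaches f s b} := by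
  rintro f ((hf | hf) | hf) <;>
    exact ⟨not_reaches_of_closed (fun x y h => (hf x y h).1)
      (by grind [Finset.mem_compl]) (by grind [Finset.mem_compl]),
      not_reaches_of_closed (fun x y h => (hf x y h).2)
      (by grind [Finset.mem_compl]) (by grind [Finset.mem_compl])⟩

theorem abs_PrGnp_not_reaches_inter_sub_le (h0 : 0 ≤ p) (h1 : p ≤ 1) {a s b : Fin N}
    (has : a ≠ s) (hsb : s ≠ b) (hab : a ≠ b) (hN : 24 ≤ N) :
    |PrGnp N p {f | ¬ Reaches f a s ∧ ¬ Reaches f s b} - 3 * (1 - p / 2) ^ (2 * N - 3)| ≤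
      3 * tailBound N p 3 + (1 - p) ^ (N - 1) := by
  have hw := configWeight_nonneg (N := N) h0 h1
  have hr : 0 ≤ (1 - p) ^ (N - 1) := pow_nonneg (by linarith) _
  have cb : ({b}ᶜ : Finset (Fin N)).card = N - 1 := by simp [Finset.card_compl]
  have csb : ({s, b}ᶜ : Finset (Fin N)).card = N - 2 := by
    rw [Finset.card_compl, Finset.card_pair hsb, Fintype.card_fin]
  have h₁ : PrGnp N p (closedConfigs {a} {a, s}) = (1 - p / 2) ^ (2 * N - 3) := by
    rw [PrGnp_closedConfigs h0 h1 (by simp), Finset.card_pair has, Finset.card_singleton]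
    congr 1
    omega
  have h₂ : PrGnp N p (closedConfigs {a} {b}ᶜ) = (1 - p / 2) ^ (2 * N - 3) := by
    rw [PrGnp_closedConfigs h0 h1 (by simpa using hab.symm), cb, Finset.card_singleton,
      show N - (N - 1) = 1 by omega]
    congr 1
    omega
  have h₃ : PrGnp N p (closedConfigs {s, b}ᶜ {b}ᶜ) = (1 - p / 2) ^ (2 * N - 3) := by
    rw [PrGnp_closedConfigs h0 h1 (by simp), cb, csb,
      show N - (N - 1) = 1 by omega, show N - 1 - (N - 2) = 1 by omega]
    congr 1
    omega
  have h₁₂ : PrGnp N p (closedConfigs {a} {a, s} ∩ closedConfigs {a} {b}ᶜ) ≤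
      tailBound N p 3 := by
    refine (prWeight_mono hw (F := closedConfigs {a, s} {b}ᶜ)
      fun f hf u v huv => ⟨(hf.1 u v huv).2, (hf.2 u v huv).2⟩).trans ?_
    refine (PrGnp_closedConfigs h0 h1 (by grind [Finset.mem_compl])).trans_le ?_
    rw [cb, Finset.card_pair has, show N - (N - 1) = 1 by omega]
    exact pow_le_tailBound h0 h1 (by omega)
  have h₃₂ : PrGnp N p ((closedConfigs {a} {a, s} ∪ closedConfigs {a} {b}ᶜ) ∩
      closedConfigs {s, b}ᶜ {b}ᶜ) ≤ tailBound N p 3 := by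
    refine (prWeight_mono hw (F := closedConfigs {a} {s, b}ᶜ) ?_).trans ?_
    · rintro f ⟨hf | hf, hf'⟩ u v huv <;> exact ⟨(hf u v huv).1, (hf' u v huv).1⟩
    refine (PrGnp_closedConfigs h0 h1 (by grind [Finset.mem_compl])).trans_le ?_
    rw [csb, Finset.card_singleton, show N - (N - 2) = 2 by omega]
    exact pow_le_tailBound h0 h1 (by omega)
  have hlow := prWeight_mono hw (subset_not_reaches_inter has hsb hab)
  have hup := (prWeight_mono hw (not_reaches_inter_subset has hsb hab hN)).trans
    (prWeight_union_le hw _ _)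
  have hup' := prWeight_union_le hw (closedConfigs {s}ᶜ {s}) (highCostConfigs N 3)
  have hie := prWeight_union_add_inter (w := fun f => ∏ e : Edge N, edgeWeight p (f e))
    (closedConfigs {a} {a, s}) (closedConfigs {a} {b}ᶜ)
  have hie' := prWeight_union_add_inter (w := fun f => ∏ e : Edge N, edgeWeight p (f e))
    (closedConfigs {a} {a, s} ∪ closedConfigs {a} {b}ᶜ) (closedConfigs {s, b}ᶜ {b}ᶜ)
  have hT := PrGnp_highCostConfigs_le (N := N) h0 h1 3
  have hI := PrGnp_isolated h0 h1 s
  have hnn := prWeight_nonneg hw (closedConfigs {a} {a, s} ∩ closedConfigs {a} {b}ᶜ)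
  have hnn' := prWeight_nonneg hw ((closedConfigs {a} {a, s} ∪ closedConfigs {a} {b}ᶜ) ∩
      closedConfigs {s, b}ᶜ {b}ᶜ)
  have hTnn := (prWeight_nonneg hw (highCostConfigs N 3)).trans hT
  unfold PrGnp at *
  rw [abs_le]
  constructor <;> linarith

end ClosedSets

section Asymptotics

theorem tailBound_le {N k : ℕ} {p : ℝ} (h0 : 0 ≤ p) (h1 : p ≤ 1) (hk1 : 1 ≤ k) (hk3 : k ≤ 3)
    (hN : 24 ≤ N) :
    tailBound N p k ≤ (1 - p / 2) ^ ((k - 1) * N) *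
      ((1 - p / 2) ^ (N / 2 - 9) * (4 * exp (3 * (N * (1 - p / 2) ^ (N / 8))))) := by
  have hq : 0 ≤ 1 - p / 2 := by linarith
  have hq1 : 1 - p / 2 ≤ 1 := by linarith
  rw [← mul_assoc, ← pow_add, tailBound]
  gcongr ?_ * (4 * ?_)
  · refine pow_le_pow_of_le_one hq hq1 ?_
    interval_cases k <;> omega
  · calc (1 + 3 * (1 - p / 2) ^ (N / 8)) ^ N ≤ exp (3 * (1 - p / 2) ^ (N / 8)) ^ N := by
          gcongr
          linarith [add_one_le_exp (3 * (1 - p / 2) ^ (N / 8))]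
      _ = _ := by
          rw [← exp_nat_mul]
          ring_nf

theorem tendsto_nat_mul_pow_div_eight {q : ℝ} (h0 : 0 ≤ q) (h1 : q < 1) :
    Tendsto (fun N : ℕ => N * q ^ (N / 8)) atTop (nhds 0) := by
  have hdiv : Tendsto (fun N : ℕ => N / 8) atTop atTop := Nat.tendsto_div_const_atTop (by norm_num)
  have h2 := (tendsto_self_mul_const_pow_of_lt_one h0 h1).const_mul 8
  have h3 := (tendsto_pow_atTop_nhds_zero_of_lt_one h0 h1).const_mul 8
  have h4 := (h2.add h3).comp hdiv
  simp only [mul_zero, add_zero] at h4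
  refine squeeze_zero (fun N => by positivity) (fun N => ?_) h4
  have : (N : ℝ) ≤ 8 * (N / 8 : ℕ) + 8 := by
    exact_mod_cast (by omega : N ≤ 8 * (N / 8) + 8)
  calc (N : ℝ) * q ^ (N / 8) ≤ (8 * (N / 8 : ℕ) + 8) * q ^ (N / 8) := by gcongr
    _ = _ := by simp only [Function.comp_apply]; ring

theorem tendsto_tailBound_div {p : ℝ} (h0 : 0 < p) (h1 : p ≤ 1) {k : ℕ} (hk1 : 1 ≤ k)
    (hk3 : k ≤ 3) :
    Tendsto (fun N : ℕ => tailBound N p k / (1 - p / 2) ^ ((k - 1) * N)) atTop (nhds 0) := by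
  have hq : 0 < 1 - p / 2 := by linarith
  have hq1 : 1 - p / 2 < 1 := by linarith
  have hexp : Tendsto (fun N : ℕ => N / 2 - 9) atTop atTop :=
    (tendsto_sub_atTop_nat 9).comp (Nat.tendsto_div_const_atTop (by norm_num))
  have ha := (tendsto_pow_atTop_nhds_zero_of_lt_one hq.le hq1).comp hexp
  have hb := ((continuous_exp.tendsto _).comp
    ((tendsto_nat_mul_pow_div_eight hq.le hq1).const_mul 3)).const_mul 4
  have hab := ha.mul hb
  rw [zero_mul] at hab
  refine squeeze_zero' (Eventually.of_forall fun N => ?_) ?_ hab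
  · unfold tailBound
    positivity
  · filter_upwards [eventually_ge_atTop 24] with N hN
    rw [div_le_iff₀ (by positivity), mul_comm]
    exact tailBound_le h0.le h1 hk1 hk3 hN

theorem div_pow_eq_mul_pow_div_pow {q : ℝ} (c : ℝ) (hq : q ≠ 0) {d e i : ℕ} (h : e = d + i) :
    c / q ^ i = c * q ^ d / q ^ e := by
  rw [h, pow_add, mul_comm (q ^ d), mul_div_mul_right _ _ (pow_ne_zero d hq)]

theorem tendsto_of_abs_sub_le_const {l : Filter ℕ} {u w : ℕ → ℝ} {x : ℝ}
    (h : ∀ᶠ n in l, |u n - x| ≤ w n) (hw : Tendsto w l (nhds 0)) : Tendsto u l (nhds x) := by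
  rw [tendsto_iff_dist_tendsto_zero]
  exact squeeze_zero' (Eventually.of_forall fun _ => dist_nonneg) h hw

theorem tendsto_PrGnp_not_reaches_div {p : ℝ} (h0 : 0 < p) (h1 : p ≤ 1)
    (u v : (n : ℕ) → Fin (n + 3)) (huv : ∀ n, u n ≠ v n) :
    Tendsto (fun n => PrGnp (n + 3) p {f | ¬ Reaches f (u n) (v n)} / (1 - p / 2) ^ (n + 3)) atTop
      (nhds (2 / (1 - p / 2))) := by
  have hq : 0 < 1 - p / 2 := by linarith
  have hT := (tendsto_tailBound_div h0 h1 (k := 2) (by norm_num) (by norm_num)).comp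
    (tendsto_add_atTop_nat 3)
  refine tendsto_of_abs_sub_le_const ?_ hT
  filter_upwards [eventually_ge_atTop 21] with n hn
  have h := abs_PrGnp_not_reaches_sub_le h0.le h1 (huv n) (by omega)
  have e : 2 / (1 - p / 2) = 2 * (1 - p / 2) ^ (n + 3 - 1) / (1 - p / 2) ^ (n + 3) := by
    simpa using div_pow_eq_mul_pow_div_pow 2 hq.ne' (show n + 3 = n + 3 - 1 + 1 by omega)
  rw [e, ← sub_div, abs_div, abs_of_pos (a := (1 - p / 2) ^ (n + 3)) (by positivity)]
  simp only [Function.comp_apply, Nat.add_one_sub_one, one_mul]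
  gcongr
  exact h

theorem tendsto_PrGnp_not_reaches_inter_div {p : ℝ} (h0 : 0 < p) (h1 : p ≤ 1)
    (s a b : (n : ℕ) → Fin (n + 3))
    (hsa : ∀ n, s n ≠ a n) (hsb : ∀ n, s n ≠ b n) (hab : ∀ n, a n ≠ b n) :
    Tendsto (fun n => PrGnp (n + 3) p {f | ¬ Reaches f (a n) (s n) ∧ ¬ Reaches f (s n) (b n)} /
      (1 - p / 2) ^ (2 * (n + 3))) atTop (nhds (3 / (1 - p / 2) ^ 3)) := by
  have hq : 0 < 1 - p / 2 := by linarith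
  have hr : 0 ≤ 1 - p := by linarith
  have hT := (tendsto_tailBound_div h0 h1 (k := 3) (by norm_num) (by norm_num)).comp
    (tendsto_add_atTop_nat 3)
  have hratio : (1 - p) / (1 - p / 2) ^ 2 < 1 := by
    rw [div_lt_one (by positivity)]
    nlinarith [sq_pos_of_pos h0]
  have hI := ((tendsto_pow_atTop_nhds_zero_of_lt_one (by positivity) hratio).comp
    (tendsto_add_atTop_nat 2)).div_const ((1 - p / 2) ^ 2)
  have hw := (hT.const_mul 3).add hI
  rw [mul_zero, zero_div, add_zero] at hw
  refine tendsto_of_abs_sub_le_const ?_ hw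
  filter_upwards [eventually_ge_atTop 21] with n hn
  have h := abs_PrGnp_not_reaches_inter_sub_le h0.le h1 (hsa n).symm (hsb n) (hab n) (by omega)
  have e : 3 / (1 - p / 2) ^ 3 =
      3 * (1 - p / 2) ^ (2 * (n + 3) - 3) / (1 - p / 2) ^ (2 * (n + 3)) :=
    div_pow_eq_mul_pow_div_pow 3 hq.ne' (by omega)
  rw [e, ← sub_div, abs_div, abs_of_pos (a := (1 - p / 2) ^ (2 * (n + 3))) (by positivity)]
  calc _ ≤ (3 * tailBound (n + 3) p 3 + (1 - p) ^ (n + 3 - 1)) / (1 - p / 2) ^ (2 * (n + 3)) := by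
        gcongr
    _ = _ := by
        simp only [Function.comp_apply, show 3 - 1 = 2 from rfl, show n + 3 - 1 = n + 2 by omega]
        rw [div_pow, div_div, ← pow_mul, ← pow_add, show 2 * (n + 2) + 2 = 2 * (n + 3) by ring]
        ring

end Asymptotics

/-- Fix `p ∈ (0,1]`. For three fixed distinct vertices `s, a, b` of
`⃗G(n,p)` (graphs on `n + 3 ≥ 3` vertices) the relative covariance of the events
`{a ↛ s}` and `{s ↛ b}` tends to `(2p - 1)/3` as `n → ∞`. -/
theorem gnp_relative_covariance_tendsto
    (p : ℝ) (hp : p ∈ Set.Ioc (0 : ℝ) 1)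
    (s a b : (n : ℕ) → Fin (n + 3))
    (hsa : ∀ n, s n ≠ a n) (hsb : ∀ n, s n ≠ b n) (hab : ∀ n, a n ≠ b n) :
    Filter.Tendsto (fun n : ℕ =>
        (PrGnp (n + 3) p {f | ¬ Reaches f (a n) (s n) ∧ ¬ Reaches f (s n) (b n)} -
            PrGnp (n + 3) p {f | ¬ Reaches f (a n) (s n)} *
              PrGnp (n + 3) p {f | ¬ Reaches f (s n) (b n)}) /
          PrGnp (n + 3) p {f | ¬ Reaches f (a n) (s n) ∧ ¬ Reaches f (s n) (b n)})
      Filter.atTop (nhds ((2 * p - 1) / 3)) := by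
  obtain ⟨h0, h1⟩ := hp
  have hq : 0 < 1 - p / 2 := by linarith
  have hA := tendsto_PrGnp_not_reaches_div h0 h1 a s fun n => (hsa n).symm
  have hB := tendsto_PrGnp_not_reaches_div h0 h1 s b hsb
  have hAB := tendsto_PrGnp_not_reaches_inter_div h0 h1 s a b hsa hsb hab
  have h := (hAB.sub (hA.mul hB)).div hAB (by positivity)
  have e : (3 / (1 - p / 2) ^ 3 - 2 / (1 - p / 2) * (2 / (1 - p / 2))) / (3 / (1 - p / 2) ^ 3) =
      (2 * p - 1) / 3 := by
    obtain ⟨q, rfl⟩ : ∃ q, p = 2 - 2 * q := ⟨1 - p / 2, by ring⟩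
    rw [show 1 - (2 - 2 * q) / 2 = q by ring] at hq ⊢
    field_simp
    ring
  rw [e] at h
  refine h.congr fun n => ?_
  have hne : (1 - p / 2) ^ (2 * (n + 3)) ≠ 0 := by positivity
  simp only [Pi.div_apply]
  rw [div_mul_div_comm, ← pow_add, ← two_mul, ← sub_div, div_div_div_cancel_right₀ hne]
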